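/- arXiv:1303.0714 — 4 statements merged into one kernel-verified Lean document; each statement's English description precedes it below -/
import Mathlib

section
/- (Theorem 2, part 1) Suppose p ∈ ℝ[x₁,…,xₙ] satisfies p = ∑_{i=1}^m f_i² for polynomials f₁,…,f_m. Then every extreme point of the Newton polytope C(p) is the image in ℝⁿ of an exponent vector α in the support of p all of whose coordinates α_j are even. -/
/-- The natural embedding of an exponent vector `α ∈ ℕⁿ` as a point of `ℝⁿ`. -/
def expVec {n : ℕ} (α : Fin n →₀ ℕ) : Fin n → ℝ := fun i => (α i : ℝ)

open MvPolynomial in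
/-- If `β + β` is only the sum `β + β` of two exponents of `q`, then the coefficient of `q ^ 2`
at `β + β` is the square of the coefficient of `q` at `β`. -/
theorem coeff_sq_add_self {σ R : Type*} [CommSemiring R] (q : MvPolynomial σ R) (β : σ →₀ ℕ)
    (h : ∀ a ∈ q.support, ∀ b ∈ q.support, a + b = β + β → a = β ∧ b = β) :
    coeff (β + β) (q ^ 2) = coeff β q ^ 2 := by
  classical
  rw [sq, coeff_mul, sq]
  refine Finset.sum_eq_single (β, β) ?_ ?_
  · rintro ⟨a, b⟩ hab hne
    by_contra hc
    obtain ⟨rfl, rfl⟩ := h a (mem_support_iff.2 (left_ne_zero_of_mul hc)) b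
      (mem_support_iff.2 (right_ne_zero_of_mul hc)) (Finset.HasAntidiagonal.mem_antidiagonal.1 hab)
    exact hne rfl
  · exact fun hn => absurd (by simp) hn

theorem expVec_add {n : ℕ} (a b : Fin n →₀ ℕ) : expVec (a + b) = expVec a + expVec b := by
  ext j
  simp [expVec]

theorem expVec_injective {n : ℕ} : Function.Injective (expVec (n := n)) := by
  intro a b h
  ext j
  exact Nat.cast_injective (R := ℝ) (congrFun h j)

/-- The sum of two exponents is the midpoint of their doubles. -/
theorem expVec_add_mem_openSegment {n : ℕ} (a b : Fin n →₀ ℕ) :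
    expVec (a + b) ∈ openSegment ℝ (expVec (a + a)) (expVec (b + b)) := by
  refine ⟨1 / 2, 1 / 2, by norm_num, by norm_num, by norm_num, ?_⟩
  simp only [expVec_add]
  module

/-- The doubles of the exponents of the summands lie in the Newton polytope of a sum of squares. -/
theorem expVec_add_self_mem_convexHull {n : ℕ} {ι : Type*} [Fintype ι]
    (f : ι → MvPolynomial (Fin n) ℝ) {i : ι} {β : Fin n →₀ ℕ} (hβ : β ∈ (f i).support) :
    expVec (β + β) ∈
      convexHull ℝ (expVec '' ((∑ i, f i ^ 2).support : Set (Fin n →₀ ℕ))) := by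
  set S : Set (Fin n →₀ ℕ) := ⋃ i, ((f i).support : Set (Fin n →₀ ℕ))
  set D : Set (Fin n → ℝ) := (fun β => expVec (β + β)) '' S
  have hSfin : S.Finite := Set.finite_iUnion fun i => (f i).support.finite_toSet
  have hext : (convexHull ℝ D).extremePoints ℝ ⊆
      expVec '' ((∑ i, f i ^ 2).support : Set (Fin n →₀ ℕ)) := by
    intro x hx
    obtain ⟨γ, hγ, rfl⟩ := extremePoints_convexHull_subset hx
    refine ⟨γ + γ, ?_, rfl⟩
    have hmem {a} (ha : a ∈ S) : expVec (a + a) ∈ convexHull ℝ D :=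
      subset_convexHull ℝ D ⟨a, ha, rfl⟩
    have huniq : ∀ a ∈ S, ∀ b ∈ S, a + b = γ + γ → a = γ ∧ b = γ := by
      intro a ha b hb hab
      have hseg := expVec_add_mem_openSegment a b
      rw [hab] at hseg
      have h1 := expVec_injective (hx.2 (hmem ha) (hmem hb) hseg)
      rw [openSegment_symm] at hseg
      have h2 := expVec_injective (hx.2 (hmem hb) (hmem ha) hseg)
      constructor
      · ext j
        have := DFunLike.congr_fun h1 j
        simp only [Finsupp.add_apply] at this
        omega
      · ext j
        have := DFunLike.congr_fun h2 j
        simp only [Finsupp.add_apply] at this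
        omega
    obtain ⟨k, hk⟩ := Set.mem_iUnion.1 hγ
    rw [Finset.mem_coe, MvPolynomial.mem_support_iff, MvPolynomial.coeff_sum]
    rw [Finset.sum_congr rfl fun i _ => coeff_sq_add_self (f i) γ fun a ha b hb =>
      huniq a (Set.mem_iUnion.2 ⟨i, ha⟩) b (Set.mem_iUnion.2 ⟨i, hb⟩)]
    refine (Finset.sum_pos' (fun i _ => sq_nonneg _) ⟨k, Finset.mem_univ k, ?_⟩).ne'
    exact sq_pos_of_ne_zero (MvPolynomial.mem_support_iff.1 hk)
  have hcomp : IsCompact (convexHull ℝ D) := (hSfin.image _).isCompact_convexHull ℝ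
  have hclosed : IsClosed
      (convexHull ℝ (expVec '' ((∑ i, f i ^ 2).support : Set (Fin n →₀ ℕ)))) :=
    ((Finset.finite_toSet _).image _).isClosed_convexHull ℝ
  have hsub := closure_minimal (convexHull_mono hext) hclosed
  rw [closure_convexHull_extremePoints hcomp (convex_convexHull ℝ D)] at hsub
  exact hsub (subset_convexHull ℝ D ⟨β, Set.mem_iUnion.2 ⟨i, hβ⟩, rfl⟩)

/-- **Theorem 2, part 1.** If `p = ∑_{i=1}^m f_i²`, then every extreme point of the
Newton polytope `C(p)` (the convex hull of the support of `p` in `ℝⁿ`) is the image of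
an exponent vector in the support of `p` all of whose coordinates are even. -/
theorem extreme_points_even (n m : ℕ) (p : MvPolynomial (Fin n) ℝ)
    (f : Fin m → MvPolynomial (Fin n) ℝ)
    (hsos : p = ∑ i, (f i) ^ 2) :
    ∀ x ∈ Set.extremePoints ℝ (convexHull ℝ (expVec '' (p.support : Set (Fin n →₀ ℕ)))),
      ∃ α ∈ p.support, (∀ j : Fin n, Even (α j)) ∧ x = expVec α := by
  intro x hx
  obtain ⟨α, hα, rfl⟩ := extremePoints_convexHull_subset hx
  refine ⟨α, hα, ?_, rfl⟩
  subst hsos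
  have hc := MvPolynomial.mem_support_iff.1 (Finset.mem_coe.1 hα)
  rw [MvPolynomial.coeff_sum] at hc
  obtain ⟨i, -, hi⟩ := Finset.exists_ne_zero_of_sum_ne_zero hc
  rw [sq, MvPolynomial.coeff_mul] at hi
  obtain ⟨⟨β, γ⟩, hβγ, hne⟩ := Finset.exists_ne_zero_of_sum_ne_zero hi
  obtain rfl := Finset.HasAntidiagonal.mem_antidiagonal.1 hβγ
  have hβ := MvPolynomial.mem_support_iff.2 (left_ne_zero_of_mul hne)
  have hγ := MvPolynomial.mem_support_iff.2 (right_ne_zero_of_mul hne)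
  have h := expVec_injective (hx.2 (expVec_add_self_mem_convexHull f hβ)
    (expVec_add_self_mem_convexHull f hγ) (expVec_add_mem_openSegment β γ))
  intro j
  exact ⟨β j, (DFunLike.congr_fun h j).symm⟩
end

section
/- Suppose p ∈ ℝ[x₁,…,xₙ] satisfies p = ∑_{i=1}^m f_i² for polynomials f₁,…,f_m. Then every exponent vector α in the support of any f_i satisfies α ∈ (1/2)·C(p) ∩ ℕⁿ; that is, the image of α in ℝⁿ lies in the reduced Newton polytope of p. -/
open scoped Pointwise

/-- If `β` maximizes an injective additive map to an ordered monoid on the support of `f`, then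
`2 • β` arises only as `β + β`, so its coefficient in `f ^ 2` is the square of that of `β`. -/
lemma MvPolynomial.coeff_two_nsmul_sq_of_le {σ R M : Type*} [CommSemiring R]
    [AddCommMonoid M] [LinearOrder M] [IsOrderedCancelAddMonoid M]
    (φ : (σ →₀ ℕ) →+ M) (hφ : Function.Injective φ) (f : MvPolynomial σ R) (β : σ →₀ ℕ)
    (hβ : ∀ γ ∈ f.support, φ γ ≤ φ β) :
    (f ^ 2).coeff (2 • β) = f.coeff β ^ 2 := by
  classical
  rw [sq, sq, MvPolynomial.coeff_mul]
  refine Finset.sum_eq_single_of_mem (β, β) (by simp [two_nsmul]) ?_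
  rintro ⟨a, b⟩ hab hne
  rw [Finset.HasAntidiagonal.mem_antidiagonal] at hab
  dsimp only at hab ⊢
  by_contra h
  have ha := hβ a (MvPolynomial.mem_support_iff.2 (left_ne_zero_of_mul h))
  have hb := hβ b (MvPolynomial.mem_support_iff.2 (right_ne_zero_of_mul h))
  have hsum : φ a + φ b = φ β + φ β := by rw [← map_add, hab, two_nsmul, map_add]
  obtain ⟨h₁, h₂⟩ := (add_eq_add_iff_eq_and_eq ha hb).1 hsum
  exact hne (Prod.ext (hφ h₁) (hφ h₂))

/-- A linear functional on exponent vectors, with ties broken lexicographically. -/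
noncomputable def weightLex {n : ℕ} (l : (Fin n → ℝ) →ₗ[ℝ] ℝ) :
    (Fin n →₀ ℕ) →+ ℝ ×ₗ Lex (Fin n →₀ ℕ) where
  toFun α := toLex (l (expVec α), toLex α)
  map_zero' := by
    have h : expVec (0 : Fin n →₀ ℕ) = 0 := by ext; simp [expVec]
    rw [h, map_zero]
    rfl
  map_add' α β := by
    have h : expVec (α + β) = expVec α + expVec β := by ext; simp [expVec]
    rw [h, map_add]
    rfl

lemma weightLex_injective {n : ℕ} (l : (Fin n → ℝ) →ₗ[ℝ] ℝ) :
    Function.Injective (weightLex l) := fun _ _ h =>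
  congrArg (fun x : ℝ ×ₗ Lex (Fin n →₀ ℕ) => ofLex (ofLex x).2) h

lemma le_of_weightLex_le {n : ℕ} {l : (Fin n → ℝ) →ₗ[ℝ] ℝ} {α β : Fin n →₀ ℕ}
    (h : weightLex l α ≤ weightLex l β) : l (expVec α) ≤ l (expVec β) :=
  Prod.Lex.monotone_fst _ _ h

/-- If `p = ∑_{i=1}^m f_i²`, then every exponent vector in the support of any `f i`
lies (viewed as a point of `ℝⁿ`) in the reduced Newton polytope `(1/2)·C(p)` of `p`. -/
theorem support_mem_reduced_newton (n m : ℕ) (p : MvPolynomial (Fin n) ℝ)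
    (f : Fin m → MvPolynomial (Fin n) ℝ)
    (hsos : p = ∑ i, (f i) ^ 2) :
    ∀ i : Fin m, ∀ α ∈ (f i).support,
      expVec α ∈ (2⁻¹ : ℝ) • convexHull ℝ (expVec '' (p.support : Set (Fin n →₀ ℕ))) := by
  classical
  intro i α hα
  rw [Set.mem_inv_smul_set_iff₀ two_ne_zero]
  by_contra hnot
  obtain ⟨l, u, hlt, hu⟩ := geometric_hahn_banach_closed_point (convex_convexHull ℝ _)
    ((p.support.finite_toSet.image expVec).isClosed_convexHull ℝ) hnot
  let S := Finset.univ.biUnion fun j => (f j).support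
  have mem_S {j γ} (h : γ ∈ (f j).support) : γ ∈ S :=
    Finset.mem_biUnion.2 ⟨j, Finset.mem_univ j, h⟩
  obtain ⟨β, hβS, hβ⟩ := S.exists_max_image (weightLex l.toLinearMap) ⟨α, mem_S hα⟩
  obtain ⟨j, -, hj⟩ := Finset.mem_biUnion.1 hβS
  have hcoeff : p.coeff (2 • β) = ∑ k, (f k).coeff β ^ 2 := by
    rw [hsos, MvPolynomial.coeff_sum]
    exact Finset.sum_congr rfl fun k _ => MvPolynomial.coeff_two_nsmul_sq_of_le _
      (weightLex_injective _) _ _ fun γ hγ => hβ γ (mem_S hγ)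
  have hpos : 0 < p.coeff (2 • β) := by
    rw [hcoeff]
    exact Finset.sum_pos' (fun _ _ => sq_nonneg _)
      ⟨j, Finset.mem_univ j, sq_pos_of_ne_zero (MvPolynomial.mem_support_iff.1 hj)⟩
  have hmem := hlt _ (subset_convexHull ℝ _
    (Set.mem_image_of_mem expVec (MvPolynomial.mem_support_iff.2 hpos.ne')))
  have hdouble : expVec (2 • β) = (2 : ℝ) • expVec β := by ext; simp [expVec]
  have hle : l (expVec α) ≤ l (expVec β) := le_of_weightLex_le (hβ α (mem_S hα))
  rw [hdouble, map_smul, smul_eq_mul] at hmem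
  rw [map_smul, smul_eq_mul] at hu
  linarith
end

section
/- (Soundness of one pruning step) Let M ⊆ ℕⁿ be a finite set of exponent vectors and let f₁,…,f_m be polynomials each of whose supports is contained in M, and set p = ∑_{i=1}^m f_i². Let γ ∈ M be such that the only pair (α,β) ∈ M×M with α + β = 2γ is (γ,γ). If the coefficient of x^{2γ} in p is zero, then γ does not lie in the support of any f_i; i.e., the coefficient of x^γ in every f_i is zero. -/
/-- If `(γ, γ)` is the only pair of exponents of `q` summing to `γ + γ`, then the coefficient
of `x^(γ + γ)` in `q ^ 2` is the square of the coefficient of `x^γ` in `q`. -/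
theorem MvPolynomial.coeff_sq_add_self_of_unique {σ R : Type*} [CommSemiring R]
    (q : MvPolynomial σ R) (γ : σ →₀ ℕ)
    (huniq : ∀ α ∈ q.support, ∀ β ∈ q.support, α + β = γ + γ → α = γ ∧ β = γ) :
    (q ^ 2).coeff (γ + γ) = q.coeff γ ^ 2 := by
  classical
  rw [sq, sq, MvPolynomial.coeff_mul]
  refine Finset.sum_eq_single_of_mem (γ, γ) (Finset.HasAntidiagonal.mem_antidiagonal.2 rfl) ?_
  rintro ⟨α, β⟩ hαβ hne
  by_contra h
  obtain ⟨rfl, rfl⟩ := huniq α (MvPolynomial.mem_support_iff.2 (left_ne_zero_of_mul h))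
    β (MvPolynomial.mem_support_iff.2 (right_ne_zero_of_mul h))
    (Finset.HasAntidiagonal.mem_antidiagonal.1 hαβ)
  exact hne rfl

/-- **Soundness of one pruning step.** Let `M` be a finite set of exponent vectors,
let `f₁,…,f_m` have supports contained in `M`, and set `p = ∑ f_i²`.  If `γ ∈ M` is
such that `(γ,γ)` is the only pair in `M × M` summing to `2γ`, and the coefficient of
`x^{2γ}` in `p` vanishes, then the coefficient of `x^γ` in every `f i` vanishes. -/
theorem pruning_step_sound (n m : ℕ) (M : Finset (Fin n →₀ ℕ))
    (f : Fin m → MvPolynomial (Fin n) ℝ)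
    (hsupp : ∀ i : Fin m, (f i).support ⊆ M)
    (p : MvPolynomial (Fin n) ℝ)
    (hp : p = ∑ i, (f i) ^ 2)
    (γ : Fin n →₀ ℕ) (hγ : γ ∈ M)
    (huniq : ∀ α ∈ M, ∀ β ∈ M, α + β = γ + γ → α = γ ∧ β = γ)
    (hcoeff : p.coeff (γ + γ) = 0) :
    ∀ i : Fin m, (f i).coeff γ = 0 := by
  have hsq (i : Fin m) : ((f i) ^ 2).coeff (γ + γ) = (f i).coeff γ ^ 2 :=
    MvPolynomial.coeff_sq_add_self_of_unique (f i) γ fun α hα β hβ =>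
      huniq α (hsupp i hα) β (hsupp i hβ)
  simp only [hp, MvPolynomial.coeff_sum, hsq] at hcoeff
  intro i
  exact pow_eq_zero_iff two_ne_zero |>.1 <|
    (Finset.sum_eq_zero_iff_of_nonneg fun j _ => sq_nonneg ((f j).coeff γ)).1 hcoeff i
      (Finset.mem_univ i)
end

section
/- There exists a polynomial p and an exponent vector γ with γ ∈ (1/2)·C(p) ∩ ℕⁿ such that γ does not lie in the support of any f_i in any sum-of-squares decomposition of p. Concretely, for p = x₁² + x₂² + x₁⁴x₂⁴ ∈ ℝ[x₁,x₂], the vector γ = (1,1) lies in (1/2)·C(p) ∩ ℕ², yet for every decomposition p = ∑_{i=1}^m f_i² the coefficient of x₁x₂ in every f_i is zero. -/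
open scoped Pointwise

open MvPolynomial

/-- If `γ + γ` splits over the support of `f` only as `γ + γ`, then its coefficient in `f ^ 2` is
the square of the coefficient of `γ` in `f`. -/
theorem coeff_add_self_sq {σ R : Type*} [CommSemiring R] (f : MvPolynomial σ R) (γ : σ →₀ ℕ)
    (h : ∀ β ∈ f.support, ∀ δ ∈ f.support, β + δ = γ + γ → β = γ) :
    (f ^ 2).coeff (γ + γ) = f.coeff γ ^ 2 := by
  classical
  rw [sq, coeff_mul, sq]
  refine Finset.sum_eq_single (γ, γ) ?_ (by simp)
  rintro ⟨β, δ⟩ hmem hne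
  rw [Finset.HasAntidiagonal.mem_antidiagonal] at hmem
  by_contra hprod
  have hβ := h β (mem_support_iff.2 (left_ne_zero_of_mul hprod)) δ
    (mem_support_iff.2 (right_ne_zero_of_mul hprod)) hmem
  subst hβ
  exact hne (Prod.ext rfl (add_left_cancel hmem))

/-- Every exponent of a summand in a sum of squares is dominated, for an injective additive
weight, by half of an exponent of the sum. -/
theorem exists_add_self_mem_support_of_mem_support {σ ι R L : Type*} [Fintype ι]
    [Field R] [LinearOrder R] [IsStrictOrderedRing R]
    [AddCommMonoid L] [LinearOrder L] [IsOrderedCancelAddMonoid L]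
    (w : (σ →₀ ℕ) →+ L) (hw : Function.Injective w) (f : ι → MvPolynomial σ R)
    {i : ι} {β : σ →₀ ℕ} (hβ : β ∈ (f i).support) :
    ∃ α, α + α ∈ (∑ j, f j ^ 2).support ∧ w β ≤ w α := by
  classical
  set S := Finset.univ.biUnion fun j => (f j).support
  have hS : ∀ j, ∀ δ ∈ (f j).support, δ ∈ S := fun j δ hδ =>
    Finset.mem_biUnion.2 ⟨j, Finset.mem_univ j, hδ⟩
  obtain ⟨α, hα, hmax⟩ := S.exists_max_image w ⟨β, hS i β hβ⟩
  refine ⟨α, ?_, hmax β (hS i β hβ)⟩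
  obtain ⟨j, -, hj⟩ := Finset.mem_biUnion.1 hα
  have hsq : ∀ k, (f k ^ 2).coeff (α + α) = (f k).coeff α ^ 2 := fun k => by
    refine coeff_add_self_sq _ _ fun β hβ δ hδ hsum => hw ?_
    refine ((add_eq_add_iff_eq_and_eq (hmax β (hS k β hβ)) (hmax δ (hS k δ hδ))).1 ?_).1
    rw [← map_add, hsum, map_add]
  rw [mem_support_iff, coeff_sum, Finset.sum_congr rfl fun k _ => hsq k]
  exact (Finset.sum_pos' (fun k _ => sq_nonneg ((f k).coeff α))
    ⟨j, Finset.mem_univ j, sq_pos_of_ne_zero (mem_support_iff.1 hj)⟩).ne'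

/-- The additive weight `α ↦ r α₀ + s α₁` on bivariate exponents. -/
noncomputable def bivariateWeight (r s : ℝ) : (Fin 2 →₀ ℕ) →+ ℝ where
  toFun α := r * α 0 + s * α 1
  map_zero' := by simp
  map_add' α β := by
    simp only [Finsupp.add_apply, Nat.cast_add]
    ring

theorem bivariateWeight_apply (r s : ℝ) (α : Fin 2 →₀ ℕ) :
    bivariateWeight r s α = r * α 0 + s * α 1 := rfl

theorem add_mul_sqrt_three_injective {a b c d : ℤ}
    (h : (a : ℝ) + √3 * b = c + √3 * d) : a = c ∧ b = d := by
  have hirr : Irrational √3 := by simpa using Nat.prime_three.irrational_sqrt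
  have hbd : b = d := by
    by_contra hne
    have hne' : (b : ℝ) - d ≠ 0 := sub_ne_zero.2 (by exact_mod_cast hne)
    refine hirr ⟨((c - a : ℤ) : ℚ) / ((b - d : ℤ) : ℚ), ?_⟩
    push_cast
    rw [div_eq_iff hne']
    linarith
  subst hbd
  exact ⟨by exact_mod_cast add_right_cancel h, rfl⟩

theorem bivariateWeight_neg_one_sqrt_three_injective :
    Function.Injective (bivariateWeight (-1) √3) := fun α β h => by
  simp only [bivariateWeight_apply] at h
  have := add_mul_sqrt_three_injective (a := -α 0) (b := α 1) (c := -β 0) (d := β 1)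
    (by push_cast; linarith)
  ext i
  fin_cases i <;> simp <;> omega

theorem bivariateWeight_sqrt_three_neg_one_injective :
    Function.Injective (bivariateWeight √3 (-1)) := fun α β h => by
  simp only [bivariateWeight_apply] at h
  have := add_mul_sqrt_three_injective (a := -α 1) (b := α 0) (c := -β 1) (d := β 0)
    (by push_cast; linarith)
  ext i
  fin_cases i <;> simp <;> omega

theorem bivariateWeight_neg_one_neg_sqrt_three_injective :
    Function.Injective (bivariateWeight (-1) (-√3)) := fun α β h => by
  simp only [bivariateWeight_apply] at h
  have := add_mul_sqrt_three_injective (a := α 0) (b := α 1) (c := β 0) (d := β 1)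
    (by push_cast; linarith)
  ext i
  fin_cases i <;> simp <;> omega

/-- Membership in the support of `x₁² + x₂² + x₁⁴x₂⁴`. -/
theorem mem_support_sq_add_sq_add_pow_four_mul (α : Fin 2 →₀ ℕ) :
    α ∈ (X 0 ^ 2 + X 1 ^ 2 + X 0 ^ 4 * X 1 ^ 4 : MvPolynomial (Fin 2) ℝ).support ↔
      (α 0 = 2 ∧ α 1 = 0) ∨ (α 0 = 0 ∧ α 1 = 2) ∨ (α 0 = 4 ∧ α 1 = 4) := by
  classical
  have hext : ∀ β : Fin 2 →₀ ℕ, β = α ↔ β 0 = α 0 ∧ β 1 = α 1 := fun β => by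
    simp [Finsupp.ext_iff, Fin.forall_fin_two]
  simp only [mem_support_iff, X_pow_eq_monomial, monomial_mul, coeff_add, coeff_monomial, hext]
  simp only [Finsupp.add_apply, Finsupp.single_apply]
  norm_num
  split_ifs <;> norm_num <;> omega

/-- For `p = x₁² + x₂² + x₁⁴x₂⁴`, the exponent vector `γ = (1,1)` lies in the reduced
Newton polytope `(1/2)·C(p) ∩ ℕ²`, yet in every sum-of-squares decomposition
`p = ∑_{i=1}^m f_i²` the coefficient of `x₁x₂` in every `f i` is zero.  Hence the zero
diagonal algorithm can return a strictly smaller monomial set than the Newton polytope. -/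
theorem newton_polytope_not_tight :
    ∃ (p : MvPolynomial (Fin 2) ℝ) (γ : Fin 2 →₀ ℕ),
      p = MvPolynomial.X 0 ^ 2 + MvPolynomial.X 1 ^ 2 +
            MvPolynomial.X 0 ^ 4 * MvPolynomial.X 1 ^ 4 ∧
      γ = Finsupp.single 0 1 + Finsupp.single 1 1 ∧
      expVec γ ∈ (2⁻¹ : ℝ) • convexHull ℝ (expVec '' (p.support : Set (Fin 2 →₀ ℕ))) ∧
      ∀ (m : ℕ) (f : Fin m → MvPolynomial (Fin 2) ℝ),
        p = ∑ i, (f i) ^ 2 → ∀ i : Fin m, (f i).coeff γ = 0 := by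
  refine ⟨_, _, rfl, rfl, ?_, fun m f hf => ?_⟩
  · have hmem : ∀ a b : ℕ, (a = 2 ∧ b = 0) ∨ (a = 0 ∧ b = 2) ∨ (a = 4 ∧ b = 4) →
        (![(a : ℝ), b] : Fin 2 → ℝ) ∈ convexHull ℝ (expVec '' ((X 0 ^ 2 + X 1 ^ 2 +
          X 0 ^ 4 * X 1 ^ 4 : MvPolynomial (Fin 2) ℝ).support : Set (Fin 2 →₀ ℕ))) := by
      intro a b hab
      refine subset_convexHull ℝ _ ⟨Finsupp.equivFunOnFinite.symm ![a, b], ?_, ?_⟩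
      · rw [Finset.mem_coe, mem_support_sq_add_sq_add_pow_four_mul]
        simpa using hab
      · ext i
        fin_cases i <;> simp [expVec]
    have hconv := convex_convexHull ℝ (expVec '' ((X 0 ^ 2 + X 1 ^ 2 +
      X 0 ^ 4 * X 1 ^ 4 : MvPolynomial (Fin 2) ℝ).support : Set (Fin 2 →₀ ℕ)))
    have hmid := hconv (hmem 2 0 (by simp)) (hmem 0 2 (by simp))
      (show (0 : ℝ) ≤ 1 / 2 by norm_num) (show (0 : ℝ) ≤ 1 / 2 by norm_num) (by norm_num)
    have htwo := hconv hmid (hmem 4 4 (by simp))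
      (show (0 : ℝ) ≤ 2 / 3 by norm_num) (show (0 : ℝ) ≤ 1 / 3 by norm_num) (by norm_num)
    refine ⟨_, htwo, ?_⟩
    ext i
    fin_cases i <;> norm_num [expVec]
  · have hs : √3 ^ 2 = 3 := Real.sq_sqrt (by norm_num)
    have hs0 : 1.7 < √3 := Real.lt_sqrt_of_sq_lt (by norm_num)
    have hs1 : √3 < 1.8 := (Real.sqrt_lt' (by norm_num)).2 (by norm_num)
    have hvertex : ∀ w : (Fin 2 →₀ ℕ) →+ ℝ, Function.Injective w →
        ∀ i, ∀ β ∈ (f i).support, ∃ α : Fin 2 →₀ ℕ, ((α 0 = 1 ∧ α 1 = 0) ∨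
          (α 0 = 0 ∧ α 1 = 1) ∨ (α 0 = 2 ∧ α 1 = 2)) ∧ w β ≤ w α := by
      intro w hw i β hβ
      obtain ⟨α, hα, hle⟩ := exists_add_self_mem_support_of_mem_support w hw f hβ
      rw [← hf, mem_support_sq_add_sq_add_pow_four_mul] at hα
      simp only [Finsupp.add_apply] at hα
      exact ⟨α, by omega, hle⟩
    have hupper : ∀ i, ∀ β ∈ (f i).support, -(β 0 : ℝ) + √3 * β 1 ≤ √3 := by
      intro i β hβ
      obtain ⟨α, hα, hle⟩ := hvertex _ bivariateWeight_neg_one_sqrt_three_injective i β hβ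
      simp only [bivariateWeight_apply] at hle
      rcases hα with ⟨h0, h1⟩ | ⟨h0, h1⟩ | ⟨h0, h1⟩ <;> rw [h0, h1] at hle <;>
        push_cast at hle <;> linarith
    have hright : ∀ i, ∀ β ∈ (f i).support, √3 * β 0 - β 1 ≤ √3 := by
      intro i β hβ
      obtain ⟨α, hα, hle⟩ := hvertex _ bivariateWeight_sqrt_three_neg_one_injective i β hβ
      simp only [bivariateWeight_apply] at hle
      rcases hα with ⟨h0, h1⟩ | ⟨h0, h1⟩ | ⟨h0, h1⟩ <;> rw [h0, h1] at hle <;>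
        push_cast at hle <;> linarith
    have hlower : ∀ i, ∀ β ∈ (f i).support, 1 ≤ (β 0 : ℝ) + √3 * β 1 := by
      intro i β hβ
      obtain ⟨α, hα, hle⟩ := hvertex _ bivariateWeight_neg_one_neg_sqrt_three_injective i β hβ
      simp only [bivariateWeight_apply] at hle
      rcases hα with ⟨h0, h1⟩ | ⟨h0, h1⟩ | ⟨h0, h1⟩ <;> rw [h0, h1] at hle <;>
        push_cast at hle <;> linarith
    set γ : Fin 2 →₀ ℕ := Finsupp.single 0 1 + Finsupp.single 1 1
    have hγ0 : γ 0 = 1 := by simp [γ]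
    have hγ1 : γ 1 = 1 := by simp [γ]
    have hexcl : ∀ i, ∀ β ∈ (f i).support, β 0 ≤ 2 → β 1 ≤ 2 →
        (β 0 = 1 ∧ β 1 = 0) ∨ (β 0 = 0 ∧ β 1 = 1) ∨ (β 0 = 1 ∧ β 1 = 1) ∨
          (β 0 = 2 ∧ β 1 = 2) := by
      intro i β hβ h0 h1
      have hu := hupper i β hβ
      have hr := hright i β hβ
      have hl := hlower i β hβ
      generalize β 0 = a at *
      generalize β 1 = b at *
      interval_cases a <;> interval_cases b <;> first
        | (exfalso; push_cast at hu hr hl; linarith)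
        | simp
    have hsq : ∀ i, (f i ^ 2).coeff (γ + γ) = (f i).coeff γ ^ 2 := fun i => by
      refine coeff_add_self_sq _ _ fun β hβ δ hδ hsum => ?_
      have e0 := DFunLike.congr_fun hsum 0
      have e1 := DFunLike.congr_fun hsum 1
      simp only [Finsupp.add_apply, hγ0, hγ1] at e0 e1
      have hβ' := hexcl i β hβ (by omega) (by omega)
      have hδ' := hexcl i δ hδ (by omega) (by omega)
      refine Finsupp.ext (Fin.forall_fin_two.2 ⟨?_, ?_⟩) <;> omega
    have hcoeff : ∑ i, (f i).coeff γ ^ 2 = 0 := by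
      rw [← Finset.sum_congr rfl fun i _ => hsq i, ← coeff_sum, ← hf, ← notMem_support_iff,
        mem_support_sq_add_sq_add_pow_four_mul]
      simp only [Finsupp.add_apply, hγ0, hγ1]
      omega
    intro i
    exact pow_eq_zero_iff two_ne_zero |>.1
      ((Finset.sum_eq_zero_iff_of_nonneg fun i _ => sq_nonneg _).1 hcoeff i (Finset.mem_univ i))
end
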